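/- Let d ≥ 1 and let A be a real d × d matrix whose operator norm (induced by the Euclidean norm) satisfies ‖A‖_op < 1. Then det(I_d − A) > 0 and −log det(I_d − A) ≤ tr(A) + ‖A‖_F²/(2·(1 − ‖A‖_op)), where ‖A‖_F = (Σ_{i,j} A_{ij}²)^{1/2} is the Frobenius norm of A. -/

import Mathlib

open scoped Matrix

noncomputable section

/-- The ℓ²→ℓ² operator norm of a real `d × d` matrix. -/
def matOpNorm {d : ℕ} (A : Matrix (Fin d) (Fin d) ℝ) : ℝ :=
  ‖LinearMap.toContinuousLinearMap
      ((Matrix.toEuclideanLin A :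
        EuclideanSpace ℝ (Fin d) →ₗ[ℝ] EuclideanSpace ℝ (Fin d)))‖

/-- The Frobenius norm of a real `d × d` matrix. -/
def matFrob {d : ℕ} (A : Matrix (Fin d) (Fin d) ℝ) : ℝ :=
  Real.sqrt (∑ i, ∑ j, A i j ^ 2)

open Matrix in
lemma hasDerivAt_det_one_sub_smul {d : ℕ} {A W : Matrix (Fin d) (Fin d) ℝ} {t : ℝ}
    (hW : (1 - t • A) * W = A) :
    HasDerivAt (fun s : ℝ => (1 - s • A).det) (-((1 - t • A).det * W.trace)) t := by
  obtain ⟨p, hp⟩ : ∃ p : Polynomial ℝ, ∀ r : ℝ,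
      (1 + r • (-W)).det = 1 + (-W).trace * r + p.eval r * r ^ 2 :=
    ⟨_, fun r => det_one_add_smul r (-W)⟩
  have heq : (fun s : ℝ => (1 - s • A).det) = fun s : ℝ =>
      (1 - t • A).det * (1 + (-W).trace * (s - t) + p.eval (s - t) * (s - t) ^ 2) := by
    funext s
    rw [← hp, ← det_mul, mul_add, mul_smul_comm, mul_neg, hW, mul_one]
    congr 1
    module
  rw [heq]
  have hlin : HasDerivAt (fun s : ℝ => s - t) 1 t := (hasDerivAt_id t).sub_const t
  have hpoly : HasDerivAt (fun s : ℝ => p.eval (s - t)) (p.derivative.eval (t - t) * 1) t :=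
    HasDerivAt.comp (h := fun s : ℝ => s - t) t (p.hasDerivAt (t - t)) hlin
  refine ((((hlin.const_mul (-W).trace).const_add 1).add
    (hpoly.mul (hlin.pow 2))).const_mul (1 - t • A).det).congr_deriv ?_
  simp

lemma norm_toLp_mulVec_le {d : ℕ} (A : Matrix (Fin d) (Fin d) ℝ) (v : Fin d → ℝ) :
    ‖WithLp.toLp 2 (A *ᵥ v)‖ ≤ matOpNorm A * ‖WithLp.toLp 2 v‖ := by
  simpa [matOpNorm, Matrix.toLpLin_toLp] using (LinearMap.toContinuousLinearMap
    ((Matrix.toEuclideanLin A :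
      EuclideanSpace ℝ (Fin d) →ₗ[ℝ] EuclideanSpace ℝ (Fin d)))).le_opNorm (WithLp.toLp 2 v)

lemma matFrob_nonneg {d : ℕ} (A : Matrix (Fin d) (Fin d) ℝ) : 0 ≤ matFrob A :=
  Real.sqrt_nonneg _

lemma matFrob_sq {d : ℕ} (A : Matrix (Fin d) (Fin d) ℝ) :
    matFrob A ^ 2 = ∑ i, ∑ j, A i j ^ 2 :=
  Real.sq_sqrt (by positivity)

lemma matFrob_sq_eq_sum_norm_col {d : ℕ} (A : Matrix (Fin d) (Fin d) ℝ) :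
    matFrob A ^ 2 = ∑ j, ‖WithLp.toLp 2 (A.col j)‖ ^ 2 := by
  simp only [matFrob_sq, EuclideanSpace.norm_sq_eq, Real.norm_eq_abs, sq_abs]
  exact Finset.sum_comm

lemma one_sub_matOpNorm_mul_norm_le {d : ℕ} (A : Matrix (Fin d) (Fin d) ℝ) {t : ℝ}
    (ht : t ∈ Set.Icc (0 : ℝ) 1) (v : Fin d → ℝ) :
    (1 - matOpNorm A) * ‖WithLp.toLp 2 v‖ ≤ ‖WithLp.toLp 2 ((1 - t • A) *ᵥ v)‖ := by
  have hsub : WithLp.toLp 2 ((1 - t • A) *ᵥ v)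
      = WithLp.toLp 2 v - t • WithLp.toLp 2 (A *ᵥ v) := by
    rw [Matrix.sub_mulVec, Matrix.one_mulVec, Matrix.smul_mulVec]
    rfl
  have htri := norm_sub_norm_le (WithLp.toLp 2 v) (t • WithLp.toLp 2 (A *ᵥ v))
  rw [← hsub, norm_smul, Real.norm_of_nonneg ht.1] at htri
  have hA := norm_toLp_mulVec_le A v
  have hle := mul_le_of_le_one_left (norm_nonneg (WithLp.toLp 2 (A *ᵥ v))) ht.2
  linarith

lemma det_one_sub_smul_ne_zero {d : ℕ} {A : Matrix (Fin d) (Fin d) ℝ} (hA : matOpNorm A < 1)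
    {t : ℝ} (ht : t ∈ Set.Icc (0 : ℝ) 1) : (1 - t • A).det ≠ 0 := by
  intro h
  obtain ⟨v, hv, hv0⟩ := Matrix.exists_mulVec_eq_zero_iff.mpr h
  have hle := one_sub_matOpNorm_mul_norm_le A ht v
  rw [hv0, WithLp.toLp_zero, norm_zero] at hle
  have hpos : 0 < ‖WithLp.toLp 2 v‖ := by simpa using hv
  nlinarith

lemma det_one_sub_smul_pos {d : ℕ} {A : Matrix (Fin d) (Fin d) ℝ} (hA : matOpNorm A < 1)
    {t : ℝ} (ht : t ∈ Set.Icc (0 : ℝ) 1) : 0 < (1 - t • A).det := by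
  by_contra! hneg
  have hcont : Continuous fun s : ℝ => (1 - s • A).det := by fun_prop
  obtain ⟨s, hs, hs0⟩ := intermediate_value_Icc' ht.1 hcont.continuousOn
    (show (0 : ℝ) ∈ Set.Icc _ _ from ⟨hneg, by simp⟩)
  exact det_one_sub_smul_ne_zero hA ⟨hs.1, hs.2.trans ht.2⟩ hs0

lemma trace_mul_le_matFrob_mul {d : ℕ} (A W : Matrix (Fin d) (Fin d) ℝ) :
    (A * W).trace ≤ matFrob A * matFrob W := by
  have hW : matFrob W = Real.sqrt (∑ i, ∑ j, W j i ^ 2) := by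
    rw [matFrob, Finset.sum_comm]
  rw [hW, matFrob]
  simp only [Matrix.trace, Matrix.diag_apply, Matrix.mul_apply, ← Finset.sum_product']
  exact Real.sum_mul_le_sqrt_mul_sqrt _ (fun x : Fin d × Fin d => A x.1 x.2) (fun x => W x.2 x.1)

lemma one_sub_matOpNorm_mul_matFrob_le {d : ℕ} {A W : Matrix (Fin d) (Fin d) ℝ}
    (hA : matOpNorm A < 1) {t : ℝ} (ht : t ∈ Set.Icc (0 : ℝ) 1) (hW : (1 - t • A) * W = A) :
    (1 - matOpNorm A) * matFrob W ≤ matFrob A := by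
  have hc : 0 ≤ 1 - matOpNorm A := by linarith
  refine le_of_sq_le_sq ?_ (matFrob_nonneg A)
  rw [mul_pow, matFrob_sq_eq_sum_norm_col, matFrob_sq_eq_sum_norm_col, Finset.mul_sum]
  refine Finset.sum_le_sum fun j _ => ?_
  rw [← mul_pow]
  have hcol : A.col j = (1 - t • A) *ᵥ W.col j := by
    conv_lhs => rw [← hW]
    rfl
  rw [hcol]
  exact pow_le_pow_left₀ (by positivity) (one_sub_matOpNorm_mul_norm_le A ht _) 2

lemma trace_le_of_one_sub_smul_mul_eq {d : ℕ} {A W : Matrix (Fin d) (Fin d) ℝ}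
    (hA : matOpNorm A < 1) {t : ℝ} (ht : t ∈ Set.Icc (0 : ℝ) 1) (hW : (1 - t • A) * W = A) :
    W.trace ≤ A.trace + t * (matFrob A ^ 2 / (1 - matOpNorm A)) := by
  have hc : 0 < 1 - matOpNorm A := by linarith
  have htr : W.trace = A.trace + t * (A * W).trace := by
    have h := congrArg Matrix.trace hW
    rw [sub_mul, one_mul, smul_mul_assoc, Matrix.trace_sub, Matrix.trace_smul, smul_eq_mul] at h
    linarith
  rw [htr]
  gcongr
  · exact ht.1
  · rw [le_div_iff₀ hc]
    have hF := mul_le_mul_of_nonneg_left (one_sub_matOpNorm_mul_matFrob_le hA ht hW)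
      (matFrob_nonneg A)
    have hCS := mul_le_mul_of_nonneg_right (trace_mul_le_matFrob_mul A W) hc.le
    linarith

/-- If `‖A‖_op < 1` then `det(I − A) > 0` and
`−log det(I − A) ≤ tr(A) + ‖A‖_F²/(2(1 − ‖A‖_op))`. -/
theorem stmt_12 (d : ℕ) (hd : 1 ≤ d) (A : Matrix (Fin d) (Fin d) ℝ)
    (hA : matOpNorm A < 1) :
    0 < (1 - A).det ∧
      -Real.log ((1 - A).det)
        ≤ A.trace + matFrob A ^ 2 / (2 * (1 - matOpNorm A)) := by
  have hpos {t : ℝ} (ht : t ∈ Set.Icc (0 : ℝ) 1) := det_one_sub_smul_pos hA ht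
  have hdet : 0 < (1 - A).det := by
    simpa using hpos (Set.right_mem_Icc.mpr zero_le_one)
  refine ⟨hdet, ?_⟩
  let K := matFrob A ^ 2 / (1 - matOpNorm A)
  let g : ℝ → ℝ := fun t => Real.log (1 - t • A).det + (t * A.trace + t ^ 2 * (K / 2))
  have hderiv : ∀ t ∈ Set.Icc (0 : ℝ) 1, ∃ g', 0 ≤ g' ∧ HasDerivAt g g' t := by
    intro t ht
    have hne := (hpos ht).ne'
    have hW : (1 - t • A) * ((1 - t • A)⁻¹ * A) = A :=
      Matrix.mul_nonsing_inv_cancel_left _ _ (isUnit_iff_ne_zero.mpr hne)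
    have htrace := trace_le_of_one_sub_smul_mul_eq hA ht hW
    refine ⟨-((1 - t • A)⁻¹ * A).trace + (A.trace + t * K), by linarith, ?_⟩
    refine (((hasDerivAt_det_one_sub_smul hW).log hne).add
      (((hasDerivAt_id t).mul_const A.trace).add
        (((hasDerivAt_id t).pow 2).mul_const (K / 2)))).congr_deriv ?_
    simp only [id_eq, Nat.cast_ofNat]
    field_simp
    ring
  have hmono : MonotoneOn g (Set.Icc 0 1) := by
    refine monotoneOn_of_deriv_nonneg (convex_Icc 0 1) (fun t ht => ?_) (fun t ht => ?_)
      fun t ht => ?_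
    · obtain ⟨_, -, h⟩ := hderiv t ht
      exact h.continuousAt.continuousWithinAt
    · obtain ⟨_, -, h⟩ := hderiv t (interior_subset ht)
      exact h.differentiableAt.differentiableWithinAt
    · obtain ⟨_, h0, h⟩ := hderiv t (interior_subset ht)
      rwa [h.deriv]
  have h01 := hmono (Set.left_mem_Icc.mpr zero_le_one) (Set.right_mem_Icc.mpr zero_le_one)
    zero_le_one
  have hK : matFrob A ^ 2 / (2 * (1 - matOpNorm A)) = K / 2 := by
    rw [mul_comm, div_mul_eq_div_div]
  rw [hK]
  simp only [g, zero_smul, one_smul, sub_zero, Matrix.det_one, Real.log_one] at h01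
  linarith

end
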